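/- Let N ≥ 2. Then lim_{s → (1/2)⁻} (1 - 2s) · P_s(B_1) = ( 2N · π^(N/2) / ( Γ(N/2 + 1)^(1/N) · Γ((N+1)/2) ) ) · |B_1|^((N-1)/N), where B_1 is the open unit ball in ℝ^N. -/

import Mathlib

open MeasureTheory Real Filter
open scoped ENNReal Topology

/-- The fractional `s`-perimeter of a set `E ⊆ ℝ^N`:
`P_s(E) = ∫∫ |1_E(x) - 1_E(y)|² / |x-y|^(N+2s) dx dy`, as an element of `[0,∞]`. -/
noncomputable def fracPerimeter (N : ℕ) (s : ℝ) (E : Set (EuclideanSpace ℝ (Fin N))) : ℝ≥0∞ :=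
  ∫⁻ x, ∫⁻ y, ENNReal.ofReal
    (|E.indicator (fun _ => (1 : ℝ)) x - E.indicator (fun _ => (1 : ℝ)) y| ^ 2
      / ‖x - y‖ ^ ((N : ℝ) + 2 * s))


noncomputable def auxB (u : ℝ) : ℝ := (Set.Iio (1 : ℝ)).indicator (fun _ => (1 : ℝ)) u

lemma measurable_auxB : Measurable auxB :=
  measurable_const.indicator measurableSet_Iio

noncomputable def auxJ (u v : ℝ) : ℝ≥0∞ := ENNReal.ofReal (|auxB u - auxB v| ^ 2)

lemma measurable_auxJ {α : Type*} [MeasurableSpace α] {f g : α → ℝ} (hf : Measurable f)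
    (hg : Measurable g) : Measurable (fun x => auxJ (f x) (g x)) := by
  have h1 := measurable_auxB.comp hf
  have h2 := measurable_auxB.comp hg
  exact (((h1.sub h2).abs).pow_const 2).ennreal_ofReal

lemma auxJ_slice (q r : ℝ) (hr : 0 ≤ r) :
    ∫⁻ t : ℝ, auxJ (t ^ 2 + q) ((t + r) ^ 2 + q)
      = ENNReal.ofReal (2 * min r (2 * √(1 - q))) := by
  set l := √(1 - q) with hl
  have hl0 : 0 ≤ l := Real.sqrt_nonneg _
  have key : ∀ t : ℝ, t ^ 2 + q < 1 ↔ (-l < t ∧ t < l) := by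
    intro t
    rw [← abs_lt, hl, Real.lt_sqrt (abs_nonneg t), sq_abs]
    constructor <;> intro h <;> linarith
  have e1 : ∀ t : ℝ, t ≠ -l → t ≠ l - r → auxJ (t ^ 2 + q) ((t + r) ^ 2 + q) =
      (Set.Ioo (max (-l) (l - r)) l).indicator 1 t
      + (Set.Ioo (-l - r) (min (l - r) (-l))).indicator (1 : ℝ → ℝ≥0∞) t := by
    intro t h1 h2
    have h1' := lt_or_gt_of_ne h1
    have h2' := lt_or_gt_of_ne h2
    simp only [auxJ, auxB, Set.indicator_apply, Set.mem_Iio, key, Set.mem_Ioo, max_lt_iff,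
      lt_min_iff, Pi.one_apply]
    split_ifs <;> first | (exfalso; grind) | simp
  have e2 : (fun t : ℝ => auxJ (t ^ 2 + q) ((t + r) ^ 2 + q)) =ᵐ[volume] fun t =>
      (Set.Ioo (max (-l) (l - r)) l).indicator 1 t
      + (Set.Ioo (-l - r) (min (l - r) (-l))).indicator (1 : ℝ → ℝ≥0∞) t := by
    filter_upwards [Measure.ae_ne volume (-l), Measure.ae_ne volume (l - r)] with t h1 h2
    exact e1 t h1 h2
  rw [lintegral_congr_ae e2, lintegral_add_left (measurable_one.indicator measurableSet_Ioo),
    lintegral_indicator_one measurableSet_Ioo, lintegral_indicator_one measurableSet_Ioo,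
    Real.volume_Ioo, Real.volume_Ioo, ← ENNReal.ofReal_add]
  · congr 1
    rcases le_total (-l) (l - r) with h | h
    · rw [max_eq_right h, min_eq_right h, min_eq_left (by linarith)]; ring
    · rw [max_eq_left h, min_eq_left h, min_eq_right (by linarith)]; ring
  · have := max_le (show -l ≤ l by linarith) (show l - r ≤ l by linarith)
    linarith
  · have := le_min (show -l - r ≤ l - r by linarith) (show -l - r ≤ -l by linarith)
    linarith

lemma rot_lemma (n : ℕ) (h : EuclideanSpace ℝ (Fin (n+1))) :
    ∫⁻ x : EuclideanSpace ℝ (Fin (n+1)), auxJ (‖x‖ ^ 2) (‖x + h‖ ^ 2)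
      = ∫⁻ x : EuclideanSpace ℝ (Fin (n+1)),
        auxJ (‖x‖ ^ 2) (‖x + EuclideanSpace.single 0 ‖h‖‖ ^ 2) := by
  have hn : ‖h‖ = ‖(EuclideanSpace.single 0 ‖h‖ : EuclideanSpace ℝ (Fin (n+1)))‖ := by simp
  set w := (EuclideanSpace.single 0 ‖h‖ : EuclideanSpace ℝ (Fin (n+1)))
  set R := Submodule.reflection (Submodule.span ℝ {h - w})ᗮ
  have hR : R h = w := Submodule.reflection_sub hn
  symm
  rw [← (LinearIsometryEquiv.measurePreserving R).lintegral_comp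
    (measurable_auxJ (by fun_prop) (by fun_prop))]
  refine lintegral_congr fun x => ?_
  rw [← hR, ← map_add, LinearIsometryEquiv.norm_map, LinearIsometryEquiv.norm_map]

lemma coord_lemma (n : ℕ) (r : ℝ) (hr : 0 ≤ r) :
    ∫⁻ x : EuclideanSpace ℝ (Fin (n+1)),
        auxJ (‖x‖ ^ 2) (‖x + EuclideanSpace.single 0 r‖ ^ 2)
      = ∫⁻ y : Fin n → ℝ, ENNReal.ofReal (2 * min r (2 * √(1 - ∑ i, y i ^ 2))) := by
  have mp := (volume_preserving_piFinSuccAbove (fun _ : Fin (n+1) => ℝ) 0).comp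
    (PiLp.volume_preserving_ofLp (Fin (n+1)))
  have hm : Measurable (fun p : ℝ × (Fin n → ℝ) =>
      auxJ (p.1 ^ 2 + ∑ i, p.2 i ^ 2) ((p.1 + r) ^ 2 + ∑ i, p.2 i ^ 2)) :=
    measurable_auxJ (by fun_prop) (by fun_prop)
  have h1 := mp.lintegral_comp hm
  calc _ = _ := ?_
    _ = _ := h1
    _ = _ := ?_
  · refine lintegral_congr fun x => ?_
    simp only [EuclideanSpace.real_norm_sq_eq, Fin.sum_univ_succ]
    simp [MeasurableEquiv.piFinSuccAbove, Fin.tail]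
  · rw [Measure.volume_eq_prod, lintegral_prod_symm' _ hm]
    refine lintegral_congr fun y => ?_
    exact auxJ_slice (∑ i, y i ^ 2) r hr

lemma oneD (s a : ℝ) (hs : 0 < s) (hs' : s < 1/2) (ha : 0 ≤ a) :
    IntegrableOn (fun r : ℝ => 2 * min r a * r ^ (-1 - 2 * s)) (Set.Ioi 0) ∧
    ∫ r in Set.Ioi (0:ℝ), 2 * min r a * r ^ (-1 - 2 * s)
      = a ^ (1 - 2 * s) / (s * (1 - 2 * s)) := by
  rcases ha.eq_or_lt with rfl | ha
  · have : ∀ r ∈ Set.Ioi (0:ℝ), 2 * min r 0 * r ^ (-1 - 2 * s) = 0 := by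
      intro r hr
      rw [min_eq_right (le_of_lt hr)]; simp
    constructor
    · exact (integrableOn_congr_fun this measurableSet_Ioi).2 integrableOn_zero
    · rw [setIntegral_congr_fun measurableSet_Ioi this, Real.zero_rpow (by linarith)]; simp
  have e1 : Set.EqOn (fun r : ℝ => 2 * min r a * r ^ (-1 - 2 * s)) (fun r => 2 * r ^ (-2 * s))
      (Set.Ioc 0 a) := by
    intro r hr
    simp only
    rw [min_eq_left hr.2, mul_assoc]
    congr 1
    nth_rewrite 1 [← Real.rpow_one r]
    rw [← Real.rpow_add hr.1]; congr 1; ring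
  have e2 : Set.EqOn (fun r : ℝ => 2 * min r a * r ^ (-1 - 2 * s))
      (fun r => 2 * a * r ^ (-1 -2 * s)) (Set.Ioi a) := by
    intro r hr
    simp only
    rw [min_eq_right (le_of_lt hr)]
  have i1 : IntegrableOn (fun r : ℝ => 2 * min r a * r ^ (-1 - 2 * s)) (Set.Ioc 0 a) := by
    rw [integrableOn_congr_fun e1 measurableSet_Ioc]
    have := (intervalIntegral.intervalIntegrable_rpow' (a := 0) (b := a) (r := -2 * s) (by linarith))
    rw [intervalIntegrable_iff_integrableOn_Ioc_of_le ha.le] at this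
    exact this.const_mul 2
  have i2 : IntegrableOn (fun r : ℝ => 2 * min r a * r ^ (-1 - 2 * s)) (Set.Ioi a) := by
    rw [integrableOn_congr_fun e2 measurableSet_Ioi]
    exact (integrableOn_Ioi_rpow_of_lt (by linarith) ha).const_mul _
  rw [← Set.Ioc_union_Ioi_eq_Ioi ha.le]
  refine ⟨i1.union i2, ?_⟩
  rw [setIntegral_union (Set.Ioc_disjoint_Ioi le_rfl) measurableSet_Ioi i1 i2,
    setIntegral_congr_fun measurableSet_Ioc e1, setIntegral_congr_fun measurableSet_Ioi e2,
    integral_const_mul, integral_const_mul, ← intervalIntegral.integral_of_le ha.le,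
    integral_rpow (Or.inl (by linarith)), integral_Ioi_rpow_of_lt (by linarith) ha,
    Real.zero_rpow (by linarith)]
  have h1 : a ^ (1 - 2 * s) = a * a ^ (-1 - 2 * s + 1) := by
    nth_rewrite 2 [← Real.rpow_one a]
    rw [← Real.rpow_add ha]; congr 1; ring
  have h2 : -2 * s + 1 = 1 - 2 * s := by ring
  rw [h2]
  have h3 : a * (-a ^ (-1 - 2 * s + 1) / (-1 - 2 * s + 1)) = a ^ (1 - 2 * s) / (2 * s) := by
    rw [h1, show -1 - 2 * s + 1 = - (2 * s) by ring]
    field_simp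
  rw [mul_assoc, h3]
  have : 1 - 2 * s ≠ 0 := by linarith
  field_simp
  ring

lemma polar (n : ℕ) (s a : ℝ) (hs : 0 < s) (hs' : s < 1/2) (ha : 0 ≤ a) :
    ∫⁻ h : EuclideanSpace ℝ (Fin (n+1)), ENNReal.ofReal (2 * min ‖h‖ a) *
        ENNReal.ofReal (1 / ‖h‖ ^ (((n+1 : ℕ) : ℝ) + 2 * s))
      = ENNReal.ofReal ((n + 1) *
        (volume (Metric.ball (0 : EuclideanSpace ℝ (Fin (n+1))) 1)).toReal / (s * (1 - 2 * s))
          * a ^ (1 - 2 * s)) := by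
  have e : Set.EqOn (fun y : ℝ ↦ y ^ (Module.finrank ℝ (EuclideanSpace ℝ (Fin (n+1))) - 1) •
      (2 * min y a * (1 / y ^ (((n+1 : ℕ) : ℝ) + 2 * s))))
      (fun r : ℝ => 2 * min r a * r ^ (-1 - 2 * s)) (Set.Ioi 0) := by
    intro r hr
    have hr : 0 < r := hr
    simp only [finrank_euclideanSpace, Fintype.card_fin, Nat.add_sub_cancel, smul_eq_mul]
    rw [one_div, ← Real.rpow_neg hr.le, ← Real.rpow_natCast]
    rw [mul_left_comm, ← Real.rpow_add hr]
    congr 2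
    push_cast; ring
  obtain ⟨i, v⟩ := oneD s a hs hs' ha
  have i' := (integrable_fun_norm_addHaar (volume : Measure (EuclideanSpace ℝ (Fin (n+1))))
    (f := fun y => 2 * min y a * (1 / y ^ (((n+1 : ℕ) : ℝ) + 2 * s)))).2
    ((integrableOn_congr_fun e measurableSet_Ioi).2 i)
  have v' := (integral_fun_norm_addHaar (volume : Measure (EuclideanSpace ℝ (Fin (n+1))))
    (f := fun y => 2 * min y a * (1 / y ^ (((n+1 : ℕ) : ℝ) + 2 * s))))
  rw [setIntegral_congr_fun measurableSet_Ioi e, v] at v'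
  have : ∀ h : EuclideanSpace ℝ (Fin (n+1)), ENNReal.ofReal (2 * min ‖h‖ a) *
        ENNReal.ofReal (1 / ‖h‖ ^ (((n+1 : ℕ) : ℝ) + 2 * s)) = ENNReal.ofReal
        (2 * min ‖h‖ a * (1 / ‖h‖ ^ (((n+1 : ℕ) : ℝ) + 2 * s))) := fun h =>
    (ENNReal.ofReal_mul (by positivity)).symm
  simp_rw [this]
  rw [← ofReal_integral_eq_lintegral_ofReal i' (ae_of_all _ fun h => by positivity), v']
  congr 1
  simp [Measure.real]
  ring

lemma frac_eq (n : ℕ) (s : ℝ) (hs : 0 < s) (hs' : s < 1/2) :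
    fracPerimeter (n+1) s (Metric.ball (0 : EuclideanSpace ℝ (Fin (n+1))) 1)
      = ∫⁻ y : Fin n → ℝ, ENNReal.ofReal ((n + 1) *
        (volume (Metric.ball (0 : EuclideanSpace ℝ (Fin (n+1))) 1)).toReal / (s * (1 - 2 * s))
          * (2 * √(1 - ∑ i, y i ^ 2)) ^ (1 - 2 * s)) := by
  have hind : ∀ x : EuclideanSpace ℝ (Fin (n+1)),
      (Metric.ball (0 : EuclideanSpace ℝ (Fin (n+1))) 1).indicator (fun _ => (1 : ℝ)) x
        = auxB (‖x‖ ^ 2) := by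
    intro x
    have hx : x ∈ Metric.ball (0 : EuclideanSpace ℝ (Fin (n+1))) 1 ↔ ‖x‖ ^ 2 < 1 := by simp
    by_cases h : ‖x‖ ^ 2 < 1
    · rw [Set.indicator_of_mem (hx.2 h), auxB, Set.indicator_of_mem (Set.mem_Iio.2 h)]
    · rw [Set.indicator_of_notMem (fun h' => h (hx.1 h')), auxB,
        Set.indicator_of_notMem (fun h' => h (Set.mem_Iio.1 h'))]
  have hw : Measurable (fun h : EuclideanSpace ℝ (Fin (n+1)) =>
      ENNReal.ofReal (1 / ‖h‖ ^ (((n+1 : ℕ) : ℝ) + 2 * s))) := by fun_prop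
  calc fracPerimeter (n+1) s (Metric.ball (0 : EuclideanSpace ℝ (Fin (n+1))) 1)
      = ∫⁻ x : EuclideanSpace ℝ (Fin (n+1)), ∫⁻ h : EuclideanSpace ℝ (Fin (n+1)),
        auxJ (‖x‖ ^ 2) (‖x + h‖ ^ 2) *
          ENNReal.ofReal (1 / ‖h‖ ^ (((n+1 : ℕ) : ℝ) + 2 * s)) := by
        unfold fracPerimeter
        refine lintegral_congr fun x => ?_
        rw [← lintegral_add_left_eq_self _ x]
        refine lintegral_congr fun h => ?_
        rw [hind, hind, auxJ, ← ENNReal.ofReal_mul (by positivity), sub_add_cancel_left, norm_neg,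
          mul_one_div]
    _ = ∫⁻ h : EuclideanSpace ℝ (Fin (n+1)), ∫⁻ x : EuclideanSpace ℝ (Fin (n+1)),
        auxJ (‖x‖ ^ 2) (‖x + h‖ ^ 2) *
          ENNReal.ofReal (1 / ‖h‖ ^ (((n+1 : ℕ) : ℝ) + 2 * s)) := by
        refine lintegral_lintegral_swap (Measurable.aemeasurable ?_)
        exact (measurable_auxJ (by fun_prop) (by fun_prop)).mul (hw.comp measurable_snd)
    _ = ∫⁻ h : EuclideanSpace ℝ (Fin (n+1)), ∫⁻ y : Fin n → ℝ,
        ENNReal.ofReal (2 * min ‖h‖ (2 * √(1 - ∑ i, y i ^ 2))) *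
          ENNReal.ofReal (1 / ‖h‖ ^ (((n+1 : ℕ) : ℝ) + 2 * s)) := by
        refine lintegral_congr fun h => ?_
        rw [lintegral_mul_const _ (measurable_auxJ (by fun_prop) (by fun_prop)), rot_lemma,
          coord_lemma n _ (norm_nonneg h), lintegral_mul_const _ (by fun_prop)]
    _ = ∫⁻ y : Fin n → ℝ, ∫⁻ h : EuclideanSpace ℝ (Fin (n+1)),
        ENNReal.ofReal (2 * min ‖h‖ (2 * √(1 - ∑ i, y i ^ 2))) *
          ENNReal.ofReal (1 / ‖h‖ ^ (((n+1 : ℕ) : ℝ) + 2 * s)) := by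
        refine lintegral_lintegral_swap (Measurable.aemeasurable ?_)
        refine Measurable.mul ?_ (hw.comp measurable_fst)
        fun_prop
    _ = _ := by
        refine lintegral_congr fun y => ?_
        exact polar n s _ hs hs' (by positivity)

lemma frac_toReal (n : ℕ) (s : ℝ) (hs : 0 < s) (hs' : s < 1/2) :
    (1 - 2 * s) *
      (fracPerimeter (n+1) s (Metric.ball (0 : EuclideanSpace ℝ (Fin (n+1))) 1)).toReal
      = (n + 1) * (volume (Metric.ball (0 : EuclideanSpace ℝ (Fin (n+1))) 1)).toReal / s
          * ∫ y : Fin n → ℝ, (2 * √(1 - ∑ i, y i ^ 2)) ^ (1 - 2 * s) := by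
  have h1 : 0 < 1 - 2 * s := by linarith
  rw [frac_eq n s hs hs', ← integral_eq_lintegral_of_nonneg_ae, integral_const_mul]
  · field_simp
  · exact ae_of_all _ fun y => by positivity
  · exact Measurable.aestronglyMeasurable (by fun_prop)

lemma vol_D (n : ℕ) : volume {y : Fin n → ℝ | ∑ i, y i ^ 2 < 1}
    = volume (Metric.ball (0 : EuclideanSpace ℝ (Fin n)) 1) := by
  rw [← (PiLp.volume_preserving_ofLp (Fin n)).measure_preimage]
  · congr 1
    ext x
    have : ‖x‖ < 1 ↔ ‖x‖ ^ 2 < 1 := by simp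
    simp only [mem_ball_zero_iff, this, EuclideanSpace.real_norm_sq_eq]
    rfl
  · exact (measurableSet_lt (by fun_prop) (by fun_prop)).nullMeasurableSet

lemma lim_int (n : ℕ) :
    Tendsto (fun s : ℝ => ∫ y : Fin n → ℝ, (2 * √(1 - ∑ i, y i ^ 2)) ^ (1 - 2 * s))
      (𝓝[Set.Ioo (0 : ℝ) (1 / 2)] (1 / 2))
      (𝓝 (volume (Metric.ball (0 : EuclideanSpace ℝ (Fin n)) 1)).toReal) := by
  have hD : MeasurableSet {y : Fin n → ℝ | ∑ i, y i ^ 2 < 1} :=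
    measurableSet_lt (by fun_prop) (by fun_prop)
  have hfin : volume {y : Fin n → ℝ | ∑ i, y i ^ 2 < 1} ≠ ∞ := by
    rw [vol_D]; exact measure_ball_lt_top.ne
  have hlim : (volume (Metric.ball (0 : EuclideanSpace ℝ (Fin n)) 1)).toReal
      = ∫ y : Fin n → ℝ, {y : Fin n → ℝ | ∑ i, y i ^ 2 < 1}.indicator (fun _ => (1:ℝ)) y := by
    rw [integral_indicator hD]
    simp [Measure.real, vol_D]
  have hz : ∀ y : Fin n → ℝ, ¬ (∑ i, y i ^ 2 < 1) → 2 * √(1 - ∑ i, y i ^ 2) = 0 := by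
    intro y hy
    rw [Real.sqrt_eq_zero_of_nonpos (by linarith), mul_zero]
  rw [hlim]
  refine tendsto_integral_filter_of_dominated_convergence
    ({y : Fin n → ℝ | ∑ i, y i ^ 2 < 1}.indicator (fun _ => (2:ℝ))) ?_ ?_ ?_ ?_
  · exact Eventually.of_forall fun s => Measurable.aestronglyMeasurable (by fun_prop)
  · filter_upwards [self_mem_nhdsWithin] with s hs
    refine ae_of_all _ fun y => ?_
    have h1 : 0 < 1 - 2 * s := by linarith [hs.2]
    rw [Real.norm_of_nonneg (by positivity), Set.indicator_apply]
    split_ifs with h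
    · have hle : 2 * √(1 - ∑ i, y i ^ 2) ≤ 2 := by
        have : √(1 - ∑ i, y i ^ 2) ≤ 1 := by
          rw [Real.sqrt_le_left (by norm_num)]
          have : 0 ≤ ∑ i, y i ^ 2 := Finset.sum_nonneg fun i _ => sq_nonneg _
          linarith
        linarith
      calc _ ≤ (2:ℝ) ^ (1 - 2 * s) := Real.rpow_le_rpow (by positivity) hle h1.le
        _ ≤ (2:ℝ) ^ (1:ℝ) := Real.rpow_le_rpow_of_exponent_le (by norm_num) (by linarith [hs.1])
        _ = 2 := Real.rpow_one 2
    · rw [hz y h, Real.zero_rpow h1.ne']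
  · exact (integrable_indicator_iff hD).2 (integrableOn_const hfin)
  · refine ae_of_all _ fun y => ?_
    rw [Set.indicator_apply]
    split_ifs with h
    · have hpos : 0 < 2 * √(1 - ∑ i, y i ^ 2) := by
        have : 0 < √(1 - ∑ i, y i ^ 2) := Real.sqrt_pos.2 (by have h' : ∑ i, y i ^ 2 < 1 := h; linarith)
        linarith
      have hc : Continuous (fun s : ℝ => (2 * √(1 - ∑ i, y i ^ 2)) ^ (1 - 2 * s)) :=
        (Real.continuous_const_rpow hpos.ne').comp (by fun_prop)
      have := (hc.tendsto (1/2)).mono_left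
        (nhdsWithin_le_nhds (s := Set.Ioo (0 : ℝ) (1 / 2)))
      simpa using this
    · refine tendsto_const_nhds.congr' ?_
      filter_upwards [self_mem_nhdsWithin] with s hs
      have h1 : 0 < 1 - 2 * s := by linarith [hs.2]
      rw [hz y h, Real.zero_rpow h1.ne']

lemma const_eq (n : ℕ) (hn : 1 ≤ n) :
    (n + 1) * (volume (Metric.ball (0 : EuclideanSpace ℝ (Fin (n+1))) 1)).toReal / (1/2)
        * (volume (Metric.ball (0 : EuclideanSpace ℝ (Fin n)) 1)).toReal
    = ((2 * (n+1 : ℕ) * π ^ (((n+1 : ℕ) : ℝ) / 2)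
            / (Gamma (((n+1 : ℕ) : ℝ) / 2 + 1) ^ (1 / ((n+1 : ℕ) : ℝ)) *
              Gamma ((((n+1 : ℕ) : ℝ) + 1) / 2)))
          * (volume (Metric.ball (0 : EuclideanSpace ℝ (Fin (n+1))) 1)).toReal
              ^ ((((n+1 : ℕ) : ℝ) - 1) / (n+1 : ℕ))) := by
  have : Nonempty (Fin n) := ⟨⟨0, hn⟩⟩
  have hv : ∀ m : ℕ, √π ^ m = π ^ ((m : ℝ) / 2) := by
    intro m
    rw [Real.sqrt_eq_rpow, ← Real.rpow_natCast, ← Real.rpow_mul pi_pos.le]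
    congr 1; ring
  have hG : 0 < Gamma (((n+1 : ℕ) : ℝ) / 2 + 1) := Real.Gamma_pos_of_pos (by positivity)
  have hG' : 0 < Gamma ((n : ℝ) / 2 + 1) := Real.Gamma_pos_of_pos (by positivity)
  have hV : (volume (Metric.ball (0 : EuclideanSpace ℝ (Fin (n+1))) 1)).toReal
      = π ^ (((n+1 : ℕ) : ℝ) / 2) / Gamma (((n+1 : ℕ) : ℝ) / 2 + 1) := by
    rw [EuclideanSpace.volume_ball, ENNReal.ofReal_one, one_pow, one_mul, Fintype.card_fin, hv,
      ENNReal.toReal_ofReal (by positivity)]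
  have hV' : (volume (Metric.ball (0 : EuclideanSpace ℝ (Fin n)) 1)).toReal
      = π ^ ((n : ℝ) / 2) / Gamma ((n : ℝ) / 2 + 1) := by
    rw [EuclideanSpace.volume_ball, ENNReal.ofReal_one, one_pow, one_mul, Fintype.card_fin, hv,
      ENNReal.toReal_ofReal (by positivity)]
  have hN : (0:ℝ) < ((n+1 : ℕ) : ℝ) := by positivity
  have hg2 : (((n+1 : ℕ) : ℝ) + 1) / 2 = (n:ℝ) / 2 + 1 := by push_cast; ring
  rw [hg2, hV']
  set V := (volume (Metric.ball (0 : EuclideanSpace ℝ (Fin (n+1))) 1)).toReal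
  set g := Gamma (((n+1 : ℕ) : ℝ) / 2 + 1)
  have hVpos : 0 < V := by rw [hV]; positivity
  have h1 : V ^ ((((n+1 : ℕ) : ℝ) - 1) / (n+1 : ℕ)) = V / V ^ (1 / ((n+1 : ℕ) : ℝ)) := by
    rw [sub_div, div_self hN.ne', Real.rpow_sub hVpos, Real.rpow_one]
  have h2 : V ^ (1 / ((n+1 : ℕ) : ℝ)) = π ^ ((1:ℝ)/2) / g ^ (1 / ((n+1 : ℕ) : ℝ)) := by
    rw [hV, Real.div_rpow (by positivity) hG.le, ← Real.rpow_mul pi_pos.le]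
    congr 2
    field_simp
  have h3 : π ^ (((n+1 : ℕ) : ℝ) / 2) = π ^ ((n : ℝ) / 2) * π ^ ((1:ℝ)/2) := by
    rw [← Real.rpow_add pi_pos]; congr 1; push_cast; ring
  rw [h1, h2, h3]
  have hp : 0 < π ^ ((1:ℝ)/2) := by positivity
  have hgp : 0 < g ^ (1 / ((n+1 : ℕ) : ℝ)) := by positivity
  generalize g ^ (1 / ((n+1 : ℕ) : ℝ)) = gp at *
  generalize π ^ ((1:ℝ)/2) = q at *
  push_cast
  field_simp

theorem tendsto_fracPerimeter_ball_half (N : ℕ) (hN : 2 ≤ N) :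
    Tendsto
      (fun s : ℝ => (1 - 2 * s) *
        (fracPerimeter N s (Metric.ball (0 : EuclideanSpace ℝ (Fin N)) 1)).toReal)
      (𝓝[Set.Ioo (0 : ℝ) (1 / 2)] (1 / 2))
      (𝓝 ((2 * N * π ^ ((N : ℝ) / 2)
            / (Gamma ((N : ℝ) / 2 + 1) ^ (1 / (N : ℝ)) * Gamma (((N : ℝ) + 1) / 2)))
          * (volume (Metric.ball (0 : EuclideanSpace ℝ (Fin N)) 1)).toReal
              ^ (((N : ℝ) - 1) / N))) := by
  obtain ⟨n, rfl⟩ : ∃ n, N = n + 1 := ⟨N - 1, by omega⟩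
  rw [← const_eq n (by omega)]
  have h1 : Tendsto (fun s : ℝ => ((n : ℝ) + 1) *
      (volume (Metric.ball (0 : EuclideanSpace ℝ (Fin (n+1))) 1)).toReal / s)
      (𝓝[Set.Ioo (0 : ℝ) (1 / 2)] (1 / 2)) (𝓝 (((n : ℝ) + 1) *
      (volume (Metric.ball (0 : EuclideanSpace ℝ (Fin (n+1))) 1)).toReal / (1/2))) :=
    (tendsto_const_nhds.div tendsto_id (by norm_num)).mono_left nhdsWithin_le_nhds
  refine (h1.mul (lim_int n)).congr' ?_
  filter_upwards [self_mem_nhdsWithin] with s hs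
  exact (frac_toReal n s hs.1 hs.2).symm
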